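/- arXiv:1507.07192 — 3 statements merged into one kernel-verified Lean document; each statement's English description precedes it below -/
import Mathlib

section
/- Let K > 0 and let c_{ij} : Q_T → ℝ (1 ≤ i,j ≤ m) be measurable and bounded functions with c_{ij} ≥ 0 everywhere on Q_T for all i ≠ j. Let W = (w_1,…,w_m) be bounded, continuous on Ω̄ × [0,T), C^2 in x and C^1 in t on Q_T, and suppose that for each i the inequality ∂_t w_i − Δw_i − K|∇w_i| ≤ Σ_{j=1}^m c_{ij}(x,t) w_j holds at every point of D_i := {(x,t) ∈ Q_T : w_i(x,t) > 0}. If w_i ≤ 0 on the parabolic boundary ∂_P Q_T for all i, then w_i ≤ 0 everywhere in Q_T for all i = 1,…,m. -/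
open Real Set Metric MeasureTheory

/-- The Laplacian in the space variable, as the sum of second derivatives in
the coordinate directions. -/
noncomputable def lap {N : ℕ} (f : EuclideanSpace ℝ (Fin N) → ℝ)
    (x : EuclideanSpace ℝ (Fin N)) : ℝ :=
  ∑ i, iteratedFDeriv ℝ 2 f x ![EuclideanSpace.single i 1, EuclideanSpace.single i 1]

open scoped InnerProductSpace

theorem HasDerivAt.nonneg_of_forall_lt_le {g : ℝ → ℝ} {g' t a : ℝ} (hg : HasDerivAt g g' t)
    (hat : a < t) (h : ∀ s ∈ Ioo a t, g s ≤ g t) : 0 ≤ g' := by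
  have hs : Filter.Tendsto (slope g t) (nhdsWithin t (Iio t)) (nhds g') :=
    (hasDerivAt_iff_tendsto_slope.1 hg).mono_left
      (nhdsWithin_mono _ fun s hs => ne_of_lt hs)
  refine ge_of_tendsto hs ?_
  filter_upwards [Ioo_mem_nhdsLT hat] with s hs
  rw [slope_def_field]
  exact div_nonneg_of_nonpos (sub_nonpos.2 (h s hs)) (sub_nonpos.2 hs.2.le)

theorem IsLocalMax.deriv_deriv_nonpos {h : ℝ → ℝ} {x : ℝ} (hmax : IsLocalMax h x)
    (hc : ContinuousAt h x) : deriv (deriv h) x ≤ 0 := by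
  by_contra! hpos
  have hmin := isLocalMin_of_deriv_deriv_pos hpos hmax.deriv_eq_zero hc
  have heq : h =ᶠ[nhds x] fun _ => h x := by
    filter_upwards [hmax, hmin] with y h1 h2 using le_antisymm h1 h2
  have := heq.deriv.deriv_eq
  simp at this
  exact hpos.ne' this

section Touching

variable {E : Type*} [NormedAddCommGroup E] [InnerProductSpace ℝ E]

/-- First and second order conditions along the line `x + s • v` when a `C²` function is touched
from above at `x` by a paraboloid. -/
theorem fderiv_of_isLocalMax_sub_paraboloid {f : E → ℝ} {x : E} {a : ℝ}
    (hf : ContDiffAt ℝ 2 f x)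
    (hmax : IsLocalMax (fun y => f y - a * (1 + ‖y‖ ^ 2)) x) (v : E) :
    fderiv ℝ f x v = 2 * a * ⟪x, v⟫_ℝ ∧ fderiv ℝ (fderiv ℝ f) x v v ≤ 2 * a * ‖v‖ ^ 2 := by
  have hline : ∀ s : ℝ, HasDerivAt (fun s : ℝ => x + s • v) v s := fun s => by
    simpa using ((hasDerivAt_id s).smul_const v).const_add x
  have hline0 : Filter.Tendsto (fun s : ℝ => x + s • v) (nhds 0) (nhds x) := by
    simpa using (hline 0).continuousAt.tendsto
  set h : ℝ → ℝ := fun s => f (x + s • v) - a * (1 + ‖x + s • v‖ ^ 2) with hh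
  have hsq : ∀ s : ℝ, HasDerivAt (fun s : ℝ => ‖x + s • v‖ ^ 2) (2 * ⟪x + s • v, v⟫_ℝ) s :=
    fun s => (hline s).norm_sq
  have hdiff : ∀ᶠ y in nhds x, DifferentiableAt ℝ f y := by
    filter_upwards [hf.eventually (by simp)] with y hy using hy.differentiableAt (by simp)
  have hd : ∀ᶠ s in nhds (0 : ℝ), HasDerivAt h
      (fderiv ℝ f (x + s • v) v - a * (2 * ⟪x + s • v, v⟫_ℝ)) s := by
    filter_upwards [hline0.eventually hdiff] with s hs
    exact (hs.hasFDerivAt.comp_hasDerivAt s (hline s)).sub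
      (((hsq s).const_add 1).const_mul a)
  have hlmax : IsLocalMax h 0 := by
    have := hline0.eventually hmax
    simpa [IsLocalMax, IsMaxFilter, hh] using this
  have hd0 := hd.self_of_nhds
  refine ⟨?_, ?_⟩
  · have := hlmax.hasDerivAt_eq_zero hd0
    simp only [zero_smul, add_zero] at this
    linarith
  · have h2 := hlmax.deriv_deriv_nonpos hd0.continuousAt
    have heq : deriv h =ᶠ[nhds 0]
        fun s => fderiv ℝ f (x + s • v) v - a * (2 * ⟪x + s • v, v⟫_ℝ) := by
      filter_upwards [hd] with s hs using hs.deriv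
    have hfd : HasFDerivAt (fderiv ℝ f) (fderiv ℝ (fderiv ℝ f) x) (x + (0 : ℝ) • v) := by
      simpa using ((hf.fderiv_right (m := 1) (by norm_num)).differentiableAt
        (by simp)).hasFDerivAt
    have h3 : HasDerivAt (fun s : ℝ => fderiv ℝ f (x + s • v) v)
        (fderiv ℝ (fderiv ℝ f) x v v) 0 :=
      (ContinuousLinearMap.apply ℝ ℝ v).hasFDerivAt.comp_hasDerivAt (0 : ℝ)
        (hfd.comp_hasDerivAt (0 : ℝ) (hline 0))
    have h4 : HasDerivAt (fun s : ℝ => ⟪x + s • v, v⟫_ℝ) (‖v‖ ^ 2) 0 := by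
      simpa using (hline 0).inner ℝ (hasDerivAt_const (0 : ℝ) v)
    have h5 := (h3.sub ((h4.const_mul 2).const_mul a)).deriv
    rw [heq.deriv_eq] at h2
    have h6 := h5.symm.trans_le h2
    linarith

theorem norm_gradient_le_of_isLocalMax_sub_paraboloid [CompleteSpace E] {f : E → ℝ} {x : E}
    {a : ℝ} (ha : 0 ≤ a) (hf : ContDiffAt ℝ 2 f x)
    (hmax : IsLocalMax (fun y => f y - a * (1 + ‖y‖ ^ 2)) x) :
    ‖gradient f x‖ ≤ 2 * a * ‖x‖ := by
  rw [gradient, LinearIsometryEquiv.norm_map]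
  refine ContinuousLinearMap.opNorm_le_bound _ (by positivity) fun v => ?_
  rw [(fderiv_of_isLocalMax_sub_paraboloid hf hmax v).1, norm_mul, mul_assoc,
    Real.norm_of_nonneg (by positivity)]
  exact mul_le_mul_of_nonneg_left (norm_inner_le_norm x v) (by positivity)

end Touching

theorem lap_le_of_isLocalMax_sub_paraboloid {N : ℕ} {f : EuclideanSpace ℝ (Fin N) → ℝ}
    {x : EuclideanSpace ℝ (Fin N)} {a : ℝ} (hf : ContDiffAt ℝ 2 f x)
    (hmax : IsLocalMax (fun y => f y - a * (1 + ‖y‖ ^ 2)) x) :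
    lap f x ≤ 2 * N * a := by
  have : lap f x ≤ ∑ _i : Fin N, 2 * a := by
    refine Finset.sum_le_sum fun i _ => ?_
    rw [iteratedFDeriv_two_apply]
    simpa using (fderiv_of_isLocalMax_sub_paraboloid hf hmax
      (EuclideanSpace.single i (1 : ℝ))).2
  refine this.trans_eq ?_
  simp
  ring

/-- maximum principle for cooperative parabolic systems on `Q_T = Ω × (0,T)`
(inequalities required only on the positivity sets `D_i`), part (i): if `W ≤ 0` on the
parabolic boundary then `W ≤ 0` in `Q_T`. -/
theorem max_principle_cooperative
    (N m : ℕ) (hN : 1 ≤ N) (hm : 2 ≤ m)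
    (T : ℝ) (hT : 0 < T)
    (Ω : Set (EuclideanSpace ℝ (Fin N))) (hΩ : IsOpen Ω) (hΩc : IsConnected Ω)
    (K : ℝ) (hK : 0 < K)
    (c : Fin m → Fin m → EuclideanSpace ℝ (Fin N) → ℝ → ℝ)
    (hc_meas : ∀ i j, Measurable
      ((Ω ×ˢ Ioo (0 : ℝ) T).restrict fun q : EuclideanSpace ℝ (Fin N) × ℝ =>
        c i j q.1 q.2))
    (hc_bdd : ∃ M₀ : ℝ, ∀ i j, ∀ x ∈ Ω, ∀ t ∈ Ioo (0 : ℝ) T, |c i j x t| ≤ M₀)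
    (hc_coop : ∀ i j, i ≠ j → ∀ x ∈ Ω, ∀ t ∈ Ioo (0 : ℝ) T, 0 ≤ c i j x t)
    (w : Fin m → EuclideanSpace ℝ (Fin N) → ℝ → ℝ)
    (hw_cont : ∀ i, ContinuousOn (fun q : EuclideanSpace ℝ (Fin N) × ℝ => w i q.1 q.2)
      (closure Ω ×ˢ Ico (0 : ℝ) T))
    (hw_bdd : ∃ M₁ : ℝ, ∀ i, ∀ x ∈ Ω, ∀ t ∈ Ioo (0 : ℝ) T, |w i x t| ≤ M₁)
    (hw_x : ∀ i, ∀ t ∈ Ioo (0 : ℝ) T, ContDiffOn ℝ 2 (fun x => w i x t) Ω)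
    (hw_t : ∀ i, ∀ x ∈ Ω, ContDiffOn ℝ 1 (fun s => w i x s) (Ioo (0 : ℝ) T))
    (hineq : ∀ i, ∀ x ∈ Ω, ∀ t ∈ Ioo (0 : ℝ) T, 0 < w i x t →
      deriv (fun s => w i x s) t - lap (fun y => w i y t) x
          - K * ‖gradient (fun y => w i y t) x‖
        ≤ ∑ j, c i j x t * w j x t)
    (hbd_init : ∀ i, ∀ x ∈ closure Ω, w i x 0 ≤ 0)
    (hbd_lat : ∀ i, ∀ x ∈ frontier Ω, ∀ t ∈ Ioo (0 : ℝ) T, w i x t ≤ 0) :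
    ∀ i, ∀ x ∈ Ω, ∀ t ∈ Ioo (0 : ℝ) T, w i x t ≤ 0 := by
  obtain ⟨M₀, hM₀⟩ := hc_bdd
  obtain ⟨M₁, hM₁⟩ := hw_bdd
  intro i₀ x₀ hx₀ t₀ ht₀
  by_contra! hpos
  have hclΩ : ∀ x ∈ closure Ω, x ∉ frontier Ω → x ∈ Ω := fun x hx hxf => by
    by_contra hxΩ
    exact hxf (by rw [hΩ.frontier_eq]; exact ⟨hx, hxΩ⟩)
  set L : ℝ := m * M₀ + 2 * N + K + 1 with hL
  have hL0 : 0 < L := by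
    have : 0 ≤ M₀ := (abs_nonneg _).trans (hM₀ i₀ i₀ x₀ hx₀ t₀ ht₀)
    positivity
  set ε : ℝ := w i₀ x₀ t₀ / (exp (L * t₀) * (1 + ‖x₀‖ ^ 2)) with hε
  have hε0 : 0 < ε := by positivity
  set φ : EuclideanSpace ℝ (Fin N) → ℝ → ℝ :=
    fun x t => ε * exp (L * t) * (1 + ‖x‖ ^ 2) with hφ
  have hφpos : ∀ x t, 0 < φ x t := fun x t => by positivity
  have hφ₀ : φ x₀ t₀ = w i₀ x₀ t₀ := by
    simp only [hφ, hε]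
    field_simp
  have hφcont : Continuous fun q : EuclideanSpace ℝ (Fin N) × ℝ => φ q.1 q.2 := by fun_prop
  have hbound : ∀ j, ∀ x ∈ Ω, ∀ t ∈ Ioo (0 : ℝ) T, φ x t ≤ w j x t → ‖x‖ ≤ M₁ / ε := by
    intro j x hx t ht h
    rw [le_div_iff₀ hε0]
    have h1 : w j x t ≤ M₁ := (le_abs_self _).trans (hM₁ j x hx t ht)
    have h2 : 1 ≤ exp (L * t) := one_le_exp (mul_nonneg hL0.le ht.1.le)
    have h3 : ε * (1 + ‖x‖ ^ 2) ≤ φ x t := by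
      simp only [hφ]
      gcongr
      exact le_mul_of_one_le_right hε0.le h2
    have h4 : ‖x‖ ≤ 1 + ‖x‖ ^ 2 := by nlinarith [sq_nonneg (‖x‖ - 1), norm_nonneg x]
    nlinarith
  -- the contact set up to time `t₀`
  set C : Set (EuclideanSpace ℝ (Fin N) × ℝ) :=
    (closure Ω ∩ closedBall 0 (M₁ / ε)) ×ˢ Icc 0 t₀ with hC
  have hCc : IsCompact C :=
    ((isCompact_closedBall _ _).inter_left isClosed_closure).prod isCompact_Icc
  have hCsub : C ⊆ closure Ω ×ˢ Ico (0 : ℝ) T := fun q hq =>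
    ⟨hq.1.1, hq.2.1, hq.2.2.trans_lt ht₀.2⟩
  set S : Set (EuclideanSpace ℝ (Fin N) × ℝ) :=
    ⋃ j, C ∩ (fun q : EuclideanSpace ℝ (Fin N) × ℝ => w j q.1 q.2 - φ q.1 q.2) ⁻¹' Ici 0 with hS
  have hSc : IsCompact S := isCompact_iUnion fun j =>
    hCc.of_isClosed_subset ((((hw_cont j).mono hCsub).sub
      hφcont.continuousOn).preimage_isClosed_of_isClosed hCc.isClosed isClosed_Ici)
      inter_subset_left
  have hmemS : ∀ j, ∀ x ∈ Ω, ∀ t ∈ Ioc (0 : ℝ) t₀, φ x t ≤ w j x t → (x, t) ∈ S := by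
    intro j x hx t ht h
    refine mem_iUnion.2 ⟨j, ⟨⟨subset_closure hx, ?_⟩, ht.1.le, ht.2⟩, sub_nonneg.2 h⟩
    simpa using hbound j x hx t ⟨ht.1, ht.2.trans_lt ht₀.2⟩ h
  obtain ⟨⟨x, t⟩, hqS, hqmin⟩ := hSc.exists_isMinOn
    ⟨(x₀, t₀), hmemS i₀ x₀ hx₀ t₀ ⟨ht₀.1, le_rfl⟩ hφ₀.le⟩ continuous_snd.continuousOn
  obtain ⟨i, ⟨⟨hxcl, -⟩, ht0, htt₀⟩, hi⟩ := mem_iUnion.1 hqS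
  replace hi : φ x t ≤ w i x t := sub_nonneg.1 hi
  simp only at hxcl ht0 htt₀
  have htpos : 0 < t := by
    refine lt_of_le_of_ne ht0 fun h => ?_
    subst h
    exact (hφpos x 0).not_ge (hi.trans (hbd_init i x hxcl))
  have htT : t ∈ Ioo (0 : ℝ) T := ⟨htpos, htt₀.trans_lt ht₀.2⟩
  have hx : x ∈ Ω := hclΩ x hxcl fun hf =>
    (hφpos x t).not_ge (hi.trans (hbd_lat i x hf t htT))
  have hlt : ∀ j, ∀ y ∈ Ω, ∀ s ∈ Ioo 0 t, w j y s < φ y s := by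
    intro j y hy s hs
    by_contra! h
    exact hs.2.not_ge (isMinOn_iff.1 hqmin _ (hmemS j y hy s ⟨hs.1, hs.2.le.trans htt₀⟩ h))
  have hdiff : ∀ j, ∀ y ∈ Ω, DifferentiableAt ℝ (fun s => w j y s) t := fun j y hy =>
    ((hw_t j y hy).contDiffAt (Ioo_mem_nhds htT.1 htT.2)).differentiableAt (by simp)
  have hφt : ∀ y, HasDerivAt (fun s => φ y s) (L * φ y t) t := fun y => by
    have h := ((((hasDerivAt_id t).const_mul L).exp.const_mul ε).mul_const (1 + ‖y‖ ^ 2))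
    refine h.congr_deriv ?_
    simp only [hφ, id]
    ring
  have hle : ∀ j, ∀ y ∈ Ω, w j y t ≤ φ y t := fun j y hy => by
    refine le_of_tendsto_of_tendsto
      ((hdiff j y hy).continuousAt.tendsto.mono_left (nhdsWithin_le_nhds (s := Iio t)))
      ((hφt y).continuousAt.tendsto.mono_left nhdsWithin_le_nhds) ?_
    filter_upwards [Ioo_mem_nhdsLT htpos] with s hs using (hlt j y hy s hs).le
  have hieq : w i x t = φ x t := le_antisymm (hle i x hx) hi
  set a : ℝ := ε * exp (L * t) with ha
  have ha0 : 0 < a := by positivity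
  have hφa : ∀ y, φ y t = a * (1 + ‖y‖ ^ 2) := fun y => rfl
  have hf : ContDiffAt ℝ 2 (fun y => w i y t) x := (hw_x i t htT).contDiffAt (hΩ.mem_nhds hx)
  have hmax : IsLocalMax (fun y => w i y t - a * (1 + ‖y‖ ^ 2)) x := by
    filter_upwards [hΩ.mem_nhds hx] with y hy
    have := hle i y hy
    rw [hφa] at this hieq
    linarith
  have hgrad := norm_gradient_le_of_isLocalMax_sub_paraboloid ha0.le hf hmax
  have hlap := lap_le_of_isLocalMax_sub_paraboloid hf hmax
  have htime := ((hdiff i x hx).hasDerivAt.sub (hφt x)).nonneg_of_forall_lt_le htpos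
    fun s hs => by
      have := hlt i x hx s hs
      simp only [Pi.sub_apply]
      linarith
  have hsum : ∑ j, c i j x t * w j x t ≤ m * (M₀ * φ x t) := by
    have : ∑ j, c i j x t * w j x t ≤ ∑ _j : Fin m, M₀ * φ x t := by
      refine Finset.sum_le_sum fun j _ => ?_
      have hcM : c i j x t * φ x t ≤ M₀ * φ x t :=
        mul_le_mul_of_nonneg_right ((le_abs_self _).trans (hM₀ i j x hx t htT)) (hφpos x t).le
      refine le_trans ?_ hcM
      rcases eq_or_ne i j with rfl | hij
      · rw [hieq]
      · exact mul_le_mul_of_nonneg_left (hle j x hx) (hc_coop i j hij x hx t htT)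
    simpa using this
  have hmain := hineq i x hx t htT (hieq ▸ hφpos x t)
  have h1 : a ≤ φ x t := by rw [hφa]; nlinarith [sq_nonneg ‖x‖]
  have h2 : 2 * a * ‖x‖ ≤ φ x t := by rw [hφa]; nlinarith [sq_nonneg (‖x‖ - 1)]
  have h3 : K * ‖gradient (fun y => w i y t) x‖ ≤ K * φ x t :=
    mul_le_mul_of_nonneg_left (hgrad.trans h2) hK.le
  have h4 : 2 * N * a ≤ 2 * N * φ x t := mul_le_mul_of_nonneg_left h1 (by positivity)
  have h5 : L * φ x t = m * (M₀ * φ x t) + 2 * N * φ x t + K * φ x t + φ x t := by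
    rw [hL]
    ring
  linarith [hφpos x t]
end

section
/- Let K > 0, M > 0, and let c_{ij} : Q_T → ℝ (1 ≤ i,j ≤ m) be measurable and bounded functions with c_{ij} ≥ 0 everywhere on Q_T for all i ≠ j, and in addition Σ_{j=1}^m c_{ij}(x,t) ≤ 0 for all (x,t) ∈ Q_T and all i. Let W = (w_1,…,w_m) be bounded, continuous on Ω̄ × [0,T), C^2 in x and C^1 in t on Q_T, and suppose that for each i the inequality ∂_t w_i − Δw_i − K|∇w_i| ≤ Σ_{j=1}^m c_{ij}(x,t) w_j holds at every point of D_i := {(x,t) ∈ Q_T : w_i(x,t) > 0}. If w_i ≤ M on the parabolic boundary ∂_P Q_T for all i, then w_i ≤ M everywhere in Q_T for all i = 1,…,m. -/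
open Real Set Metric MeasureTheory

/-- At a local maximum the second derivative is nonpositive. -/
theorem IsLocalMax.deriv_deriv_nonpos_s9 {g : ℝ → ℝ} {a : ℝ} (h : IsLocalMax g a)
    (hg : ContinuousAt g a) : deriv (deriv g) a ≤ 0 := by
  by_contra! hpos
  have hmin := isLocalMin_of_deriv_deriv_pos hpos h.deriv_eq_zero hg
  have hconst : g =ᶠ[nhds a] fun _ => g a := by
    filter_upwards [h, hmin] with s hs hs' using le_antisymm hs hs'
  have : deriv (deriv g) a = 0 := by
    rw [hconst.deriv.deriv_eq]
    simp
  linarith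

/-- At a local maximum the second derivative along any direction is nonpositive. -/
theorem IsLocalMax.iteratedFDeriv_two_nonpos {E : Type*} [NormedAddCommGroup E]
    [NormedSpace ℝ E] {f : E → ℝ} {x : E} (h : IsLocalMax f x) (hf : ContDiffAt ℝ 2 f x)
    (e : E) : iteratedFDeriv ℝ 2 f x ![e, e] ≤ 0 := by
  have hline : ∀ s : ℝ, HasDerivAt (fun s : ℝ => x + s • e) e s := fun s => by
    simpa using ((hasDerivAt_id s).smul_const e).const_add x
  have htend : Filter.Tendsto (fun s : ℝ => x + s • e) (nhds 0) (nhds x) := by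
    simpa using (hline 0).continuousAt.tendsto
  have hx : x + (0 : ℝ) • e = x := by simp
  have hd : ∀ᶠ y in nhds x, DifferentiableAt ℝ f y := by
    filter_upwards [hf.eventually (by simp)] with y hy using hy.differentiableAt (by simp)
  have h1 : deriv (fun s : ℝ => f (x + s • e)) =ᶠ[nhds 0]
      fun s => fderiv ℝ f (x + s • e) e := by
    filter_upwards [htend.eventually hd] with s hs
    exact (HasFDerivAt.comp_hasDerivAt (l := f) s hs.hasFDerivAt (hline s)).deriv
  have h2 : DifferentiableAt ℝ (fderiv ℝ f) (x + (0 : ℝ) • e) := by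
    rw [hx]
    exact (hf.fderiv_right (m := 1) (by norm_num)).differentiableAt (by simp)
  have h3 : HasDerivAt (fun s : ℝ => fderiv ℝ f (x + s • e) e)
      (fderiv ℝ (fderiv ℝ f) x e e) 0 := by
    have h4 : HasDerivAt (fun s : ℝ => fderiv ℝ f (x + s • e)) (fderiv ℝ (fderiv ℝ f) x e) 0 := by
      have := HasFDerivAt.comp_hasDerivAt (l := fderiv ℝ f) (0 : ℝ) h2.hasFDerivAt (hline 0)
      rwa [hx] at this
    simpa using h4.clm_apply (hasDerivAt_const (0 : ℝ) e)
  have hloc : IsLocalMax (fun s : ℝ => f (x + s • e)) 0 := by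
    have := htend.eventually h
    simpa [IsLocalMax, IsMaxFilter] using this
  have hc : ContinuousAt (fun s : ℝ => f (x + s • e)) 0 := by
    refine ContinuousAt.comp (f := fun s : ℝ => x + s • e) ?_ (hline 0).continuousAt
    rw [hx]
    exact hf.continuousAt
  have := hloc.deriv_deriv_nonpos_s9 hc
  rw [h1.deriv_eq, h3.deriv] at this
  simpa [iteratedFDeriv_two_apply] using this

/-- A function bounded on the left of a point by its value there has nonnegative derivative. -/
theorem HasDerivAt.nonneg_of_eventually_le_left {g : ℝ → ℝ} {a d : ℝ} (h : HasDerivAt g d a)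
    (hle : ∀ᶠ s in nhdsWithin a (Iio a), g s ≤ g a) : 0 ≤ d := by
  have ht := h.hasDerivWithinAt (s := Iio a)
  rw [hasDerivWithinAt_iff_tendsto_slope' (by simp)] at ht
  refine ge_of_tendsto ht ?_
  filter_upwards [hle, self_mem_nhdsWithin] with s hs hsa
  rw [slope_def_field]
  exact div_nonneg_of_nonpos (by linarith) (by simpa using (le_of_lt hsa))

/-- The Laplacian of `y ↦ a (1 + ‖y‖²)` is `2 a N`. -/
theorem lap_paraboloid {N : ℕ} (a : ℝ) (x : EuclideanSpace ℝ (Fin N)) :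
    lap (fun y => a * (1 + ‖y‖ ^ 2)) x = 2 * a * N := by
  have h1 : fderiv ℝ (fun y : EuclideanSpace ℝ (Fin N) => a * (1 + ‖y‖ ^ 2)) =
      fun y => (a * 2) • innerSL ℝ y := by
    ext1 y
    have := (((hasStrictFDerivAt_norm_sq y).hasFDerivAt.const_add 1).const_mul a).fderiv
    rw [this]
    ext z
    simp [mul_assoc]
  have h2 : fderiv ℝ (fun y : EuclideanSpace ℝ (Fin N) => (a * 2) • innerSL ℝ y) x =
      (a * 2) • innerSL ℝ :=
    ((innerSL ℝ (E := EuclideanSpace ℝ (Fin N))).hasFDerivAt.const_smul (a * 2)).fderiv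
  simp only [lap, iteratedFDeriv_two_apply, h1, h2]
  have h3 : ∀ i : Fin N, ((a * 2) • innerSL ℝ (E := EuclideanSpace ℝ (Fin N)))
      (EuclideanSpace.single i 1) (EuclideanSpace.single i 1) = 2 * a := fun i => by
    change (a * 2) * inner ℝ (EuclideanSpace.single i (1 : ℝ)) (EuclideanSpace.single i 1) = _
    rw [real_inner_self_eq_norm_sq]
    simp
    ring
  calc _ = ∑ _i : Fin N, 2 * a := Finset.sum_congr rfl fun i _ => h3 i
    _ = _ := by simp; ring

/-- The gradient of `y ↦ a (1 + ‖y‖²)` has norm `2 a ‖x‖`. -/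
theorem norm_gradient_paraboloid {N : ℕ} {a : ℝ} (ha : 0 ≤ a)
    (x : EuclideanSpace ℝ (Fin N)) :
    ‖gradient (fun y => a * (1 + ‖y‖ ^ 2)) x‖ = 2 * a * ‖x‖ := by
  have h := (((hasStrictFDerivAt_norm_sq x).hasFDerivAt.const_add 1).const_mul a).fderiv
  rw [← Nat.cast_smul_eq_nsmul ℝ] at h
  rw [gradient, LinearIsometryEquiv.norm_map, h, norm_smul, norm_smul, innerSL_apply_norm]
  simp [abs_of_nonneg ha]
  ring

/-- Comparison of the gradient and the Laplacian with those of a paraboloid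
touching from above. -/
theorem gradient_lap_of_isLocalMax {N : ℕ} {u : EuclideanSpace ℝ (Fin N) → ℝ} {a : ℝ}
    (ha : 0 ≤ a) {x : EuclideanSpace ℝ (Fin N)} (hu : ContDiffAt ℝ 2 u x)
    (h : IsLocalMax (fun y => u y - a * (1 + ‖y‖ ^ 2)) x) :
    ‖gradient u x‖ = 2 * a * ‖x‖ ∧ lap u x ≤ 2 * a * N := by
  have hb : ContDiff ℝ 2 (fun y : EuclideanSpace ℝ (Fin N) => a * (1 + ‖y‖ ^ 2)) :=
    contDiff_const.mul (contDiff_const.add (contDiff_norm_sq ℝ))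
  constructor
  · have h0 := h.fderiv_eq_zero
    rw [fderiv_fun_sub (hu.differentiableAt (by simp))
      (hb.contDiffAt.differentiableAt (by simp)), sub_eq_zero] at h0
    rw [gradient, h0, ← gradient, norm_gradient_paraboloid ha]
  · rw [← lap_paraboloid a x]
    refine Finset.sum_le_sum fun i _ => ?_
    have := h.iteratedFDeriv_two_nonpos (hu.sub hb.contDiffAt) (EuclideanSpace.single i 1)
    rw [fun_iteratedFDeriv_sub_apply hu hb.contDiffAt] at this
    simpa using this

/-- A row with nonnegative off-diagonal entries and nonpositive sum, applied to a vector
whose `i`-th entry is nonnegative and dominates all others, is nonpositive. -/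
theorem sum_mul_nonpos_of_row {ι : Type*} [Fintype ι] {c w : ι → ℝ} {i : ι}
    (hc : ∀ j, i ≠ j → 0 ≤ c j) (hsum : ∑ j, c j ≤ 0) (hpos : 0 ≤ w i)
    (hmax : ∀ j, w j ≤ w i) : ∑ j, c j * w j ≤ 0 := by
  calc ∑ j, c j * w j ≤ ∑ j, c j * w i := by
        refine Finset.sum_le_sum fun j _ => ?_
        by_cases hij : i = j
        · rw [hij]
        · exact mul_le_mul_of_nonneg_left (hmax j) (hc j hij)
    _ = (∑ j, c j) * w i := (Finset.sum_mul _ _ _).symm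
    _ ≤ 0 := mul_nonpos_of_nonpos_of_nonneg hsum hpos

/-- A finite family of functions, continuous on a closed cylinder and positive at some point,
attains its maximum if it is nonpositive outside a ball. -/
theorem exists_max_of_nonpos_outside_ball {ι E : Type*} [Finite ι] [NormedAddCommGroup E]
    [ProperSpace E] {A : Set E} (hA : IsClosed A) {τ R : ℝ}
    {v : ι → E × ℝ → ℝ} (hv : ∀ i, ContinuousOn (v i) (A ×ˢ Icc 0 τ))
    (hR : ∀ i, ∀ q ∈ A ×ˢ Icc (0 : ℝ) τ, R < ‖q.1‖ → v i q ≤ 0)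
    {i₀ : ι} {q₀ : E × ℝ} (hq₀ : q₀ ∈ A ×ˢ Icc (0 : ℝ) τ) (hpos : 0 < v i₀ q₀) :
    ∃ i, ∃ q ∈ A ×ˢ Icc (0 : ℝ) τ, 0 < v i q ∧
      ∀ j, ∀ p ∈ A ×ˢ Icc (0 : ℝ) τ, v j p ≤ v i q := by
  set S : Set (E × ℝ) := (A ∩ closedBall 0 R) ×ˢ Icc 0 τ
  have hS : IsCompact S := ((isCompact_closedBall _ _).inter_left hA).prod isCompact_Icc
  have hSA : S ⊆ A ×ˢ Icc 0 τ := prod_mono inter_subset_left subset_rfl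
  have hq₀S : q₀ ∈ S := by
    refine ⟨⟨hq₀.1, ?_⟩, hq₀.2⟩
    rw [mem_closedBall_zero_iff]
    by_contra! h
    exact absurd (hR i₀ q₀ hq₀ h) (not_le.2 hpos)
  choose q hqS hq using fun i => hS.exists_isMaxOn ⟨q₀, hq₀S⟩ ((hv i).mono hSA)
  have : Nonempty ι := ⟨i₀⟩
  obtain ⟨i, hi⟩ := Finite.exists_max fun i => v i (q i)
  have hqpos : 0 < v i (q i) := hpos.trans_le ((hq i₀ hq₀S).trans (hi i₀))
  refine ⟨i, q i, hSA (hqS i), hqpos, fun j p hp => ?_⟩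
  by_cases h : R < ‖p.1‖
  · exact (hR j p hp h).trans hqpos.le
  · exact (hq j ⟨⟨hp.1, by simpa using h⟩, hp.2⟩ : v j p ≤ v j (q j)).trans (hi j)

/-- maximum principle for cooperative parabolic systems on `Q_T = Ω × (0,T)`,
part (ii): under the additional row-sum condition `Σ_j c_{ij} ≤ 0`, if `W ≤ M` on the
parabolic boundary then `W ≤ M` in `Q_T`. -/
theorem max_principle_cooperative_M
    (N m : ℕ) (hN : 1 ≤ N) (hm : 2 ≤ m)
    (T : ℝ) (hT : 0 < T)
    (Ω : Set (EuclideanSpace ℝ (Fin N))) (hΩ : IsOpen Ω) (hΩc : IsConnected Ω)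
    (K : ℝ) (hK : 0 < K) (M : ℝ) (hM : 0 < M)
    (c : Fin m → Fin m → EuclideanSpace ℝ (Fin N) → ℝ → ℝ)
    (hc_meas : ∀ i j, Measurable
      ((Ω ×ˢ Ioo (0 : ℝ) T).restrict fun q : EuclideanSpace ℝ (Fin N) × ℝ =>
        c i j q.1 q.2))
    (hc_bdd : ∃ M₀ : ℝ, ∀ i j, ∀ x ∈ Ω, ∀ t ∈ Ioo (0 : ℝ) T, |c i j x t| ≤ M₀)
    (hc_coop : ∀ i j, i ≠ j → ∀ x ∈ Ω, ∀ t ∈ Ioo (0 : ℝ) T, 0 ≤ c i j x t)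
    (hc_sum : ∀ i, ∀ x ∈ Ω, ∀ t ∈ Ioo (0 : ℝ) T, ∑ j, c i j x t ≤ 0)
    (w : Fin m → EuclideanSpace ℝ (Fin N) → ℝ → ℝ)
    (hw_cont : ∀ i, ContinuousOn (fun q : EuclideanSpace ℝ (Fin N) × ℝ => w i q.1 q.2)
      (closure Ω ×ˢ Ico (0 : ℝ) T))
    (hw_bdd : ∃ M₁ : ℝ, ∀ i, ∀ x ∈ Ω, ∀ t ∈ Ioo (0 : ℝ) T, |w i x t| ≤ M₁)
    (hw_x : ∀ i, ∀ t ∈ Ioo (0 : ℝ) T, ContDiffOn ℝ 2 (fun x => w i x t) Ω)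
    (hw_t : ∀ i, ∀ x ∈ Ω, ContDiffOn ℝ 1 (fun s => w i x s) (Ioo (0 : ℝ) T))
    (hineq : ∀ i, ∀ x ∈ Ω, ∀ t ∈ Ioo (0 : ℝ) T, 0 < w i x t →
      deriv (fun s => w i x s) t - lap (fun y => w i y t) x
          - K * ‖gradient (fun y => w i y t) x‖
        ≤ ∑ j, c i j x t * w j x t)
    (hbd_init : ∀ i, ∀ x ∈ closure Ω, w i x 0 ≤ M)
    (hbd_lat : ∀ i, ∀ x ∈ frontier Ω, ∀ t ∈ Ioo (0 : ℝ) T, w i x t ≤ M) :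
    ∀ i, ∀ x ∈ Ω, ∀ t ∈ Ioo (0 : ℝ) T, w i x t ≤ M := by
  intro i₀ x₀ hx₀ t₀ ht₀
  by_contra! hlt
  obtain ⟨M₁, hM₁⟩ := hw_bdd
  set L : ℝ := 2 * N + K + 1 with hL
  have hLpos : 0 < L := by positivity
  set φ : EuclideanSpace ℝ (Fin N) × ℝ → ℝ := fun q => exp (L * q.2) * (1 + ‖q.1‖ ^ 2) with hφ
  have hφpos : ∀ q, 0 < φ q := fun q => by positivity
  obtain ⟨ε, hε, hε₀⟩ : ∃ ε : ℝ, 0 < ε ∧ ε * φ (x₀, t₀) < w i₀ x₀ t₀ - M :=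
    ⟨(w i₀ x₀ t₀ - M) / (2 * φ (x₀, t₀)), div_pos (by linarith) (by linarith [hφpos (x₀, t₀)]), by
      have := (hφpos (x₀, t₀)).ne'
      field_simp
      linarith⟩
  set v : Fin m → EuclideanSpace ℝ (Fin N) × ℝ → ℝ :=
    fun i q => w i q.1 q.2 - M - ε * φ q with hv
  have hle : ∀ i, ∀ q ∈ closure Ω ×ˢ Icc (0 : ℝ) t₀,
      w i q.1 q.2 ≤ M ∨ (q.1 ∈ Ω ∧ q.2 ∈ Ioo (0 : ℝ) T) := by
    rintro i ⟨x, t⟩ ⟨hx, ht⟩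
    rcases ht.1.eq_or_lt with h0 | h0
    · left
      simp only at h0
      simpa [← h0] using hbd_init i x hx
    · have htT : t ∈ Ioo (0 : ℝ) T := ⟨h0, ht.2.trans_lt ht₀.2⟩
      by_cases hxΩ : x ∈ Ω
      · exact Or.inr ⟨hxΩ, htT⟩
      · exact Or.inl (hbd_lat i x ⟨hx, by rwa [hΩ.interior_eq]⟩ t htT)
  have hcont : ∀ i, ContinuousOn (v i) (closure Ω ×ˢ Icc 0 t₀) := fun i => by
    refine ((((hw_cont i).mono (prod_mono subset_rfl ?_)).sub continuousOn_const).sub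
      (Continuous.continuousOn (by fun_prop)))
    exact fun s hs => ⟨hs.1, hs.2.trans_lt ht₀.2⟩
  have hout : ∀ i, ∀ q ∈ closure Ω ×ˢ Icc (0 : ℝ) t₀, |M₁| / ε + 1 < ‖q.1‖ → v i q ≤ 0 := by
    intro i q hq hR
    have hεφ : 0 < ε * φ q := mul_pos hε (hφpos q)
    rcases hle i q hq with h | ⟨hx, ht⟩
    · simp only [hv]
      linarith
    · have h1 := (le_abs_self _).trans (hM₁ i q.1 hx q.2 ht)
      have h2 : 1 ≤ exp (L * q.2) := one_le_exp (mul_nonneg hLpos.le ht.1.le)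
      have h0 : 0 ≤ |M₁| / ε := by positivity
      have h3 : |M₁| / ε ≤ φ q := by
        have : 1 + ‖q.1‖ ^ 2 ≤ φ q := le_mul_of_one_le_left (by positivity) h2
        nlinarith
      have h4 : |M₁| ≤ ε * φ q := by
        rw [div_le_iff₀ hε] at h3
        linarith
      have h5 := le_abs_self M₁
      simp only [hv]
      linarith
  obtain ⟨i, ⟨x, t⟩, hq, hpos, hmax⟩ := exists_max_of_nonpos_outside_ball isClosed_closure hcont
    hout (q₀ := (x₀, t₀)) (i₀ := i₀) ⟨subset_closure hx₀, ht₀.1.le, le_rfl⟩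
    (by simp only [hv]; linarith)
  have hεφ : 0 < ε * φ (x, t) := mul_pos hε (hφpos _)
  have hwpos : M < w i x t := by
    simp only [hv] at hpos
    linarith
  obtain ⟨hx, ht⟩ : x ∈ Ω ∧ t ∈ Ioo (0 : ℝ) T :=
    (hle i (x, t) hq).resolve_left (not_le.2 hwpos)
  have htt : t ≤ t₀ := hq.2.2
  have hsum : ∑ j, c i j x t * w j x t ≤ 0 := by
    refine sum_mul_nonpos_of_row (fun j hj => hc_coop i j hj x hx t ht) (hc_sum i x hx t ht)
      (hM.trans hwpos).le fun j => ?_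
    have := hmax j (x, t) hq
    simp only [hv] at this
    linarith
  set a : ℝ := ε * exp (L * t) with ha
  have hapos : 0 < a := by positivity
  have hspace : IsLocalMax (fun y => w i y t - a * (1 + ‖y‖ ^ 2)) x := by
    filter_upwards [hΩ.mem_nhds hx] with y hy
    have := hmax i (y, t) ⟨subset_closure hy, hq.2⟩
    simp only [hv, hφ] at this
    simp only [ha]
    linarith
  obtain ⟨hgrad, hlap⟩ := gradient_lap_of_isLocalMax hapos.le
    ((hw_x i t ht).contDiffAt (hΩ.mem_nhds hx)) hspace
  have htime : L * (a * (1 + ‖x‖ ^ 2)) ≤ deriv (fun s => w i x s) t := by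
    have hdw : HasDerivAt (fun s => w i x s) (deriv (fun s => w i x s) t) t :=
      (((hw_t i x hx).contDiffAt (isOpen_Ioo.mem_nhds ht)).differentiableAt
        (by simp)).hasDerivAt
    have hdφ : HasDerivAt (fun s => ε * φ (x, s)) (L * (a * (1 + ‖x‖ ^ 2))) t := by
      have := (((((hasDerivAt_id t).const_mul L).exp).mul_const (1 + ‖x‖ ^ 2)).const_mul ε)
      refine this.congr_deriv ?_
      simp only [ha, id]
      ring
    refine sub_nonneg.1 ((hdw.sub hdφ).nonneg_of_eventually_le_left ?_)
    filter_upwards [Ioo_mem_nhdsLT ht.1] with s hs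
    have := hmax i (x, s) ⟨hq.1, hs.1.le, hs.2.le.trans htt⟩
    simp only [hv] at this
    simp only [Pi.sub_apply]
    linarith
  have hmain := (hineq i x hx t ht (hM.trans hwpos)).trans hsum
  rw [hgrad] at hmain
  have hsq : 0 ≤ (‖x‖ - 1) ^ 2 := sq_nonneg _
  have hstrict : 0 < L * (1 + ‖x‖ ^ 2) - 2 * N - K * (2 * ‖x‖) := by
    have hN0 : (0 : ℝ) < N := by exact_mod_cast hN
    have h1 := mul_nonneg hK.le hsq
    have h2 : 0 ≤ (N : ℝ) * ‖x‖ ^ 2 := by positivity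
    rw [hL]
    nlinarith [sq_nonneg ‖x‖]
  have := mul_pos hapos hstrict
  linarith
end

section
/- Let U = (u_1,…,u_m) be a nonnegative classical solution of (S) on an open set D ⊆ ℝ^N × ℝ. Then the function z := Σ_{i=1}^m u_i satisfies the differential inequality ∂_t z − Δz ≥ c z^p pointwise on D, where p = 2r+1 and c := m^{−p} · min_{1≤i≤m} β_{ii} > 0. -/
open Real Set Metric MeasureTheory

theorem lap_fun_sum {N : ℕ} {ι : Type*} (s : Finset ι) {f : ι → EuclideanSpace ℝ (Fin N) → ℝ}
    {x : EuclideanSpace ℝ (Fin N)} (hf : ∀ i ∈ s, ContDiffAt ℝ 2 (f i) x) :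
    lap (fun y => ∑ i ∈ s, f i y) x = ∑ i ∈ s, lap (f i) x := by
  simp only [lap]
  rw [iteratedFDeriv_fun_sum_apply (n := 2) hf, Finset.sum_comm]
  simp only [_root_.sum_apply]

theorem mul_rpow_sum_le_sum_rpow_mul_rpow {m : ℕ} (hm : 0 < m) {r : ℝ} (hr : 0 ≤ r)
    {β : Fin m → Fin m → ℝ} (hβ : ∀ i j, 0 ≤ β i j) {a : Fin m → ℝ} (ha : ∀ i, 0 ≤ a i) :
    ((m : ℝ) ^ (-(2 * r + 1)) * ⨅ i, β i i) * (∑ i, a i) ^ (2 * r + 1)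
      ≤ ∑ i, ∑ j, β i j * a i ^ r * a j ^ (r + 1) := by
  have hterm : ∀ i j, 0 ≤ β i j * a i ^ r * a j ^ (r + 1) := fun i j =>
    mul_nonneg (mul_nonneg (hβ i j) (rpow_nonneg (ha i) _)) (rpow_nonneg (ha j) _)
  obtain ⟨k, -, hk⟩ := Finset.exists_max_image Finset.univ a ⟨⟨0, hm⟩, Finset.mem_univ _⟩
  have hm' : (0 : ℝ) < m := by exact_mod_cast hm
  have hsum : ∑ i, a i ≤ m * a k := by
    simpa using Finset.sum_le_card_nsmul Finset.univ a (a k) hk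
  have hinf : ⨅ i, β i i ≤ β k k := ciInf_le (Set.finite_range _).bddBelow k
  have hinf0 : 0 ≤ ⨅ i, β i i := Real.iInf_nonneg fun i => hβ i i
  calc ((m : ℝ) ^ (-(2 * r + 1)) * ⨅ i, β i i) * (∑ i, a i) ^ (2 * r + 1)
      ≤ ((m : ℝ) ^ (-(2 * r + 1)) * ⨅ i, β i i) * (m * a k) ^ (2 * r + 1) := by
        have := Finset.sum_nonneg fun i (_ : i ∈ Finset.univ) => ha i
        gcongr
    _ = (⨅ i, β i i) * a k ^ (2 * r + 1) := by
        rw [mul_rpow hm'.le (ha k), rpow_neg hm'.le]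
        have := (rpow_pos_of_pos hm' (2 * r + 1)).ne'
        field_simp
    _ ≤ β k k * a k ^ (2 * r + 1) :=
        mul_le_mul_of_nonneg_right hinf (rpow_nonneg (ha k) _)
    _ = β k k * a k ^ r * a k ^ (r + 1) := by
        rw [mul_assoc, ← rpow_add_of_nonneg (ha k) hr (by linarith)]
        ring_nf
    _ ≤ ∑ j, β k j * a k ^ r * a j ^ (r + 1) :=
        Finset.single_le_sum (f := fun j => β k j * a k ^ r * a j ^ (r + 1))
          (fun j _ => hterm k j) (Finset.mem_univ k)
    _ ≤ ∑ i, ∑ j, β i j * a i ^ r * a j ^ (r + 1) :=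
        Finset.single_le_sum (f := fun i => ∑ j, β i j * a i ^ r * a j ^ (r + 1))
          (fun i _ => Finset.sum_nonneg fun j _ => hterm i j) (Finset.mem_univ k)

/-- the sum `z = Σ_i u_i` of the components of a nonnegative classical
solution of (S) on an open set `D ⊆ ℝ^N × ℝ` satisfies the scalar differential
inequality `∂_t z − Δz ≥ c z^p` with `c = m^{−p} min_i β_{ii} > 0` and `p = 2r+1`. -/
theorem sum_supersolution
    (N m : ℕ) (hN : 1 ≤ N) (hm : 2 ≤ m)
    (r : ℝ) (hr : 0 < r)
    (β : Fin m → Fin m → ℝ)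
    (hsym : ∀ i j, β i j = β j i)
    (hoff : ∀ i j, i ≠ j → 0 ≤ β i j)
    (hdiag : ∀ i, 0 < β i i)
    (D : Set (EuclideanSpace ℝ (Fin N) × ℝ)) (hD : IsOpen D)
    (u : Fin m → EuclideanSpace ℝ (Fin N) → ℝ → ℝ)
    (hregx : ∀ i t, ContDiffOn ℝ 2 (fun x => u i x t)
      {x : EuclideanSpace ℝ (Fin N) | (x, t) ∈ D})
    (hregt : ∀ i (x : EuclideanSpace ℝ (Fin N)),
      ContDiffOn ℝ 1 (fun s => u i x s) {s : ℝ | (x, s) ∈ D})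
    (hnonneg : ∀ i (x : EuclideanSpace ℝ (Fin N)) (t : ℝ), (x, t) ∈ D → 0 ≤ u i x t)
    (hpde : ∀ i (x : EuclideanSpace ℝ (Fin N)) (t : ℝ), (x, t) ∈ D →
      deriv (fun s => u i x s) t - lap (fun y => u i y t) x
        = ∑ j, β i j * u i x t ^ r * u j x t ^ (r + 1)) :
    ∀ (x : EuclideanSpace ℝ (Fin N)) (t : ℝ), (x, t) ∈ D →
      deriv (fun s => ∑ i, u i x s) t - lap (fun y => ∑ i, u i y t) x
        ≥ ((m : ℝ) ^ (-(2 * r + 1)) * ⨅ i, β i i) * (∑ i, u i x t) ^ (2 * r + 1) := by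
  intro x t hxt
  have hx : {y : EuclideanSpace ℝ (Fin N) | (y, t) ∈ D} ∈ nhds x :=
    (hD.preimage (by fun_prop : Continuous fun y : EuclideanSpace ℝ (Fin N) => (y, t))).mem_nhds hxt
  have ht : {s : ℝ | (x, s) ∈ D} ∈ nhds t :=
    (hD.preimage (by fun_prop : Continuous fun s : ℝ => (x, s))).mem_nhds hxt
  have hβ : ∀ i j, 0 ≤ β i j := fun i j => by
    by_cases h : i = j
    · exact h ▸ (hdiag i).le
    · exact hoff i j h
  rw [deriv_fun_sum fun i _ => ((hregt i x).contDiffAt ht).differentiableAt one_ne_zero,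
    lap_fun_sum _ fun i _ => (hregx i t).contDiffAt hx, ← Finset.sum_sub_distrib,
    Finset.sum_congr rfl fun i _ => hpde i x t hxt]
  exact mul_rpow_sum_le_sum_rpow_mul_rpow (by omega) hr.le hβ fun i => hnonneg i x t hxt
end
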